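/- arXiv:1903.01457 — 4 statements merged into one kernel-verified Lean document; each statement's English description precedes it below -/
import Mathlib

section
/- The function φ is continuously differentiable on all of ℝ (in particular φ is differentiable at 0 with φ(0) = 1 and φ′(0) = −λ₂ = −√(2r)/σ₂), φ is strictly positive and strictly decreasing on ℝ, φ(x) → +∞ as x → −∞, φ(x) → 0 as x → +∞, and φ satisfies (σ₁²/2)·φ″(x) = r·φ(x) for every x < 0 and (σ₂²/2)·φ″(x) = r·φ(x) for every x > 0. -/
open Real Filter Set

/-- The decreasing fundamental solution φ for the oscillating Brownian motion with
volatility `σ₁` on `(-∞,0)` and `σ₂` on `(0,∞)`, discount parameter `r`. -/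
noncomputable def phi (σ₁ σ₂ r x : ℝ) : ℝ :=
  if x < 0 then (1 + σ₁/σ₂)/2 * Real.exp (-(Real.sqrt (2*r)/σ₁) * x)
       + (1 - σ₁/σ₂)/2 * Real.exp (Real.sqrt (2*r)/σ₁ * x)
  else Real.exp (-(Real.sqrt (2*r)/σ₂) * x)

/-- Two differentiable functions that agree to first order at `c` glue to a differentiable
function. -/
theorem hasDerivAt_ite_lt {f g f' g' : ℝ → ℝ} {c : ℝ} (hf : ∀ x, HasDerivAt f (f' x) x)
    (hg : ∀ x, HasDerivAt g (g' x) x) (h : f c = g c) (h' : f' c = g' c) (x : ℝ) :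
    HasDerivAt (fun y => if y < c then f y else g y) (if x < c then f' x else g' x) x := by
  rcases lt_trichotomy x c with hx | rfl | hx
  · rw [if_pos hx]
    refine (hf x).congr_of_eventuallyEq ?_
    filter_upwards [Iio_mem_nhds hx] with y hy using if_pos hy
  · rw [if_neg (lt_irrefl x), ← hasDerivWithinAt_univ, ← Iic_union_Ici (a := x)]
    refine HasDerivWithinAt.union ?_ ?_
    · rw [← h']
      refine (hf x).hasDerivWithinAt.congr (fun y hy => ?_) (by simp [h])
      rcases (mem_Iic.mp hy).lt_or_eq with hlt | rfl
      · exact if_pos hlt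
      · simp [h]
    · exact (hg x).hasDerivWithinAt.congr (fun y hy => if_neg (not_lt.mpr hy)) (by simp)
  · rw [if_neg hx.not_gt]
    refine (hg x).congr_of_eventuallyEq ?_
    filter_upwards [Ioi_mem_nhds hx] with y hy using if_neg (not_lt.mpr (le_of_lt hy))

/-- Two continuous functions that agree at `c` glue to a continuous function. -/
theorem continuous_ite_lt {f g : ℝ → ℝ} {c : ℝ} (hf : Continuous f) (hg : Continuous g)
    (h : f c = g c) : Continuous (fun y => if y < c then f y else g y) := by
  have hle := Continuous.if_le hg hf continuous_const continuous_id'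
    (fun x (hx : c = x) => by rw [← hx, h])
  convert hle using 2 with y
  by_cases hy : y < c
  · rw [if_pos hy, if_neg (not_le.mpr hy)]
  · rw [if_neg hy, if_pos (not_lt.mp hy)]

theorem hasDerivAt_const_mul_exp (A k x : ℝ) :
    HasDerivAt (fun y => A * exp (k * y)) (A * k * exp (k * x)) x := by
  have h := (((hasDerivAt_id' x).const_mul k).exp).const_mul A
  exact h.congr_deriv (by ring)

/-- The derivative of `phi`. -/
noncomputable def phiDeriv (σ₁ σ₂ r x : ℝ) : ℝ :=
  if x < 0 then (1 + σ₁/σ₂)/2 * -(sqrt (2*r)/σ₁) * exp (-(sqrt (2*r)/σ₁) * x)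
       + (1 - σ₁/σ₂)/2 * (sqrt (2*r)/σ₁) * exp (sqrt (2*r)/σ₁ * x)
  else -(sqrt (2*r)/σ₂) * exp (-(sqrt (2*r)/σ₂) * x)

theorem phiDeriv_left_eq_right {σ₁ : ℝ} (σ₂ r : ℝ) (hσ₁ : σ₁ ≠ 0) :
    (1 + σ₁/σ₂)/2 * -(sqrt (2*r)/σ₁) * exp (-(sqrt (2*r)/σ₁) * 0)
       + (1 - σ₁/σ₂)/2 * (sqrt (2*r)/σ₁) * exp (sqrt (2*r)/σ₁ * 0)
      = -(sqrt (2*r)/σ₂) * exp (-(sqrt (2*r)/σ₂) * 0) := by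
  simp only [mul_zero, exp_zero, mul_one]
  field_simp
  ring

theorem hasDerivAt_phi {σ₁ : ℝ} (σ₂ r : ℝ) (hσ₁ : σ₁ ≠ 0) (x : ℝ) :
    HasDerivAt (phi σ₁ σ₂ r) (phiDeriv σ₁ σ₂ r x) x := by
  have hleft (x : ℝ) := (hasDerivAt_const_mul_exp ((1 + σ₁/σ₂)/2) (-(sqrt (2*r)/σ₁)) x).add
    (hasDerivAt_const_mul_exp ((1 - σ₁/σ₂)/2) (sqrt (2*r)/σ₁) x)
  have hright (x : ℝ) : HasDerivAt (fun y => exp (-(sqrt (2*r)/σ₂) * y))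
      (-(sqrt (2*r)/σ₂) * exp (-(sqrt (2*r)/σ₂) * x)) x := by
    simpa using hasDerivAt_const_mul_exp 1 (-(sqrt (2*r)/σ₂)) x
  refine hasDerivAt_ite_lt hleft hright ?_ (phiDeriv_left_eq_right σ₂ r hσ₁) x
  simp only [Pi.add_apply, mul_zero, exp_zero]
  ring

theorem deriv_phi {σ₁ : ℝ} (σ₂ r : ℝ) (hσ₁ : σ₁ ≠ 0) :
    deriv (phi σ₁ σ₂ r) = phiDeriv σ₁ σ₂ r :=
  funext fun x => (hasDerivAt_phi σ₂ r hσ₁ x).deriv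

theorem continuous_phiDeriv {σ₁ : ℝ} (σ₂ r : ℝ) (hσ₁ : σ₁ ≠ 0) :
    Continuous (phiDeriv σ₁ σ₂ r) :=
  continuous_ite_lt (by fun_prop) (by fun_prop) (phiDeriv_left_eq_right σ₂ r hσ₁)

theorem exp_mul_lt_exp_neg_mul {a x : ℝ} (ha : 0 < a) (hx : x < 0) :
    exp (a * x) < exp (-a * x) :=
  exp_lt_exp.mpr (by nlinarith [mul_neg_of_pos_of_neg ha hx])

theorem phi_pos {σ₁ σ₂ r : ℝ} (hσ₁ : 0 < σ₁) (hσ₂ : 0 < σ₂) (hr : 0 < r) (x : ℝ) :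
    0 < phi σ₁ σ₂ r x := by
  unfold phi
  split_ifs with hx
  · have hk : 0 < σ₁ / σ₂ := by positivity
    have hlt := exp_mul_lt_exp_neg_mul (a := sqrt (2*r)/σ₁) (by positivity) hx
    nlinarith [mul_pos hk (sub_pos.mpr hlt), exp_pos (sqrt (2*r)/σ₁ * x)]
  · exact exp_pos _

theorem phiDeriv_neg {σ₁ σ₂ r : ℝ} (hσ₁ : 0 < σ₁) (hσ₂ : 0 < σ₂) (hr : 0 < r) (x : ℝ) :
    phiDeriv σ₁ σ₂ r x < 0 := by
  unfold phiDeriv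
  split_ifs with hx
  · have hk : 0 < σ₁ / σ₂ := by positivity
    have ha : 0 < sqrt (2*r)/σ₁ := by positivity
    have hlt := exp_mul_lt_exp_neg_mul ha hx
    have hpos : 0 < (1 + σ₁/σ₂)/2 * exp (-(sqrt (2*r)/σ₁) * x)
        - (1 - σ₁/σ₂)/2 * exp (sqrt (2*r)/σ₁ * x) := by
      nlinarith [mul_pos hk (exp_pos (sqrt (2*r)/σ₁ * x)),
        mul_pos hk (exp_pos (-(sqrt (2*r)/σ₁) * x))]
    linarith [mul_pos ha hpos]
  · have hb : 0 < sqrt (2*r)/σ₂ := by positivity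
    exact mul_neg_of_neg_of_pos (neg_neg_of_pos hb) (exp_pos _)

theorem tendsto_phi_atBot {σ₁ σ₂ r : ℝ} (hσ₁ : 0 < σ₁) (hσ₂ : 0 < σ₂) (hr : 0 < r) :
    Tendsto (phi σ₁ σ₂ r) atBot atTop := by
  have ha : 0 < sqrt (2*r)/σ₁ := by positivity
  have hA : 0 < (1 + σ₁/σ₂)/2 := by positivity
  have hgrow := (tendsto_exp_atTop.comp
    (tendsto_id.const_mul_atBot_of_neg (neg_neg_of_pos ha))).const_mul_atTop hA
  have hdecay := (tendsto_exp_atBot.comp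
    (tendsto_id.const_mul_atBot ha)).const_mul ((1 - σ₁/σ₂)/2)
  refine (hgrow.atTop_add hdecay).congr' ?_
  filter_upwards [eventually_lt_atBot 0] with x hx using (if_pos hx).symm

theorem tendsto_phi_atTop (σ₁ : ℝ) {σ₂ r : ℝ} (hσ₂ : 0 < σ₂) (hr : 0 < r) :
    Tendsto (phi σ₁ σ₂ r) atTop (nhds 0) := by
  have hb : 0 < sqrt (2*r)/σ₂ := by positivity
  refine (tendsto_exp_atBot.comp
    (tendsto_id.const_mul_atTop_of_neg (neg_neg_of_pos hb))).congr' ?_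
  filter_upwards [eventually_ge_atTop 0] with x hx using (if_neg (not_lt.mpr hx)).symm

theorem deriv_phiDeriv_of_neg {σ₁ r x : ℝ} (σ₂ : ℝ) (hr : 0 ≤ r) (hx : x < 0) :
    deriv (phiDeriv σ₁ σ₂ r) x = 2 * r / σ₁^2 * phi σ₁ σ₂ r x := by
  have h : phiDeriv σ₁ σ₂ r =ᶠ[nhds x] fun x =>
      (1 + σ₁/σ₂)/2 * -(sqrt (2*r)/σ₁) * exp (-(sqrt (2*r)/σ₁) * x)
        + (1 - σ₁/σ₂)/2 * (sqrt (2*r)/σ₁) * exp (sqrt (2*r)/σ₁ * x) := by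
    filter_upwards [Iio_mem_nhds hx] with y hy using if_pos hy
  have hsq : 2 * r / σ₁^2 = (sqrt (2*r)/σ₁)^2 := by rw [div_pow, sq_sqrt (by positivity)]
  rw [h.deriv_eq, phi, if_pos hx, hsq]
  refine (((hasDerivAt_const_mul_exp _ _ x).add (hasDerivAt_const_mul_exp _ _ x)).deriv).trans ?_
  ring

theorem deriv_phiDeriv_of_pos {σ₂ r x : ℝ} (σ₁ : ℝ) (hr : 0 ≤ r) (hx : 0 < x) :
    deriv (phiDeriv σ₁ σ₂ r) x = 2 * r / σ₂^2 * phi σ₁ σ₂ r x := by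
  have h : phiDeriv σ₁ σ₂ r =ᶠ[nhds x] fun x =>
      -(sqrt (2*r)/σ₂) * exp (-(sqrt (2*r)/σ₂) * x) := by
    filter_upwards [Ioi_mem_nhds hx] with y hy using if_neg (not_lt.mpr (le_of_lt hy))
  rw [h.deriv_eq, phi, if_neg hx.not_gt, (hasDerivAt_const_mul_exp _ _ x).deriv, neg_mul_neg,
    div_mul_div_comm, mul_self_sqrt (by positivity), sq]

/-- φ is C¹ on ℝ (with φ(0)=1 and φ′(0)=−√(2r)/σ₂), strictly positive, strictly
decreasing, φ(x)→+∞ as x→−∞, φ(x)→0 as x→+∞, and (σᵢ²/2)·φ″ = r·φ on each half-line. -/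
theorem stmt_2 (σ₁ σ₂ r : ℝ) (hσ₁ : 0 < σ₁) (hσ₂ : 0 < σ₂) (hr : 0 < r) :
    ContDiff ℝ 1 (phi σ₁ σ₂ r) ∧
    phi σ₁ σ₂ r 0 = 1 ∧
    deriv (phi σ₁ σ₂ r) 0 = -(Real.sqrt (2*r)/σ₂) ∧
    (∀ x : ℝ, 0 < phi σ₁ σ₂ r x) ∧
    StrictAnti (phi σ₁ σ₂ r) ∧
    Tendsto (phi σ₁ σ₂ r) atBot atTop ∧
    Tendsto (phi σ₁ σ₂ r) atTop (nhds 0) ∧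
    (∀ x < (0:ℝ), σ₁^2/2 * deriv (deriv (phi σ₁ σ₂ r)) x = r * phi σ₁ σ₂ r x) ∧
    (∀ x > (0:ℝ), σ₂^2/2 * deriv (deriv (phi σ₁ σ₂ r)) x = r * phi σ₁ σ₂ r x) := by
  have h₁ := hσ₁.ne'
  have h₂ := hσ₂.ne'
  refine ⟨?_, by simp [phi], ?_, phi_pos hσ₁ hσ₂ hr, ?_, tendsto_phi_atBot hσ₁ hσ₂ hr,
    tendsto_phi_atTop σ₁ hσ₂ hr, fun x hx => ?_, fun x hx => ?_⟩
  · rw [contDiff_one_iff_deriv, deriv_phi σ₂ r h₁]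
    exact ⟨fun x => (hasDerivAt_phi σ₂ r h₁ x).differentiableAt, continuous_phiDeriv σ₂ r h₁⟩
  · simp [deriv_phi σ₂ r h₁, phiDeriv]
  · exact strictAnti_of_hasDerivAt_neg (hasDerivAt_phi σ₂ r h₁) (phiDeriv_neg hσ₁ hσ₂ hr)
  · rw [deriv_phi σ₂ r h₁, deriv_phiDeriv_of_neg σ₂ hr.le hx]
    field_simp
  · rw [deriv_phi σ₂ r h₁, deriv_phiDeriv_of_pos σ₁ hr.le hx]
    field_simp
end

section
/- Assume 0 < σ₁² ≤ σ₂² ≤ 2σ₁². Then for every r > 0 the function G has a unique zero c(r) in (−1, ∞). Moreover c(r) > 0 if r < 2σ₁², c(r) = 0 if r = 2σ₁², and c(r) < 0 if r > 2σ₁². -/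
open Real Filter Set

/-- The increasing fundamental solution ψ for the oscillating Brownian motion with
volatility `σ₁` on `(-∞,0)` and `σ₂` on `(0,∞)`, discount parameter `r`. -/
noncomputable def psi (σ₁ σ₂ r x : ℝ) : ℝ :=
  if x < 0 then Real.exp (Real.sqrt (2*r)/σ₁ * x)
  else (1 + σ₂/σ₁)/2 * Real.exp (Real.sqrt (2*r)/σ₂ * x)
     + (1 - σ₂/σ₁)/2 * Real.exp (-(Real.sqrt (2*r)/σ₂) * x)

/-- G(x) = ψ′(x)·(1+x)² − 2·ψ(x)·(1+x). -/
noncomputable def Gfun (σ₁ σ₂ r x : ℝ) : ℝ :=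
  deriv (psi σ₁ σ₂ r) x * (1 + x)^2 - 2 * psi σ₁ σ₂ r x * (1 + x)

/-- With `l = √(2r)/σ₂` and `s = σ₂/σ₁`, the function `ψ′(x)(1+x) − 2ψ(x)` on `[0,∞)`. -/
noncomputable def reducedG (l s x : ℝ) : ℝ :=
  l * (sinh (l * x) + s * cosh (l * x)) * (1 + x) - 2 * (cosh (l * x) + s * sinh (l * x))

lemma psi_of_nonneg (σ₁ σ₂ r : ℝ) {x : ℝ} (hx : 0 ≤ x) :
    psi σ₁ σ₂ r x = cosh (√(2 * r) / σ₂ * x) + σ₂ / σ₁ * sinh (√(2 * r) / σ₂ * x) := by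
  rw [psi, if_neg hx.not_gt, cosh_eq, sinh_eq, neg_mul]
  ring

lemma psi_of_nonpos (σ₁ σ₂ r : ℝ) {x : ℝ} (hx : x ≤ 0) :
    psi σ₁ σ₂ r x = exp (√(2 * r) / σ₁ * x) := by
  rcases hx.lt_or_eq with h | rfl
  · rw [psi, if_pos h]
  · simp [psi_of_nonneg]

lemma hasDerivAt_sinh_mul (l x : ℝ) :
    HasDerivAt (fun y => sinh (l * y)) (l * cosh (l * x)) x := by
  simpa [mul_comm] using ((hasDerivAt_id x).const_mul l).sinh

lemma hasDerivAt_cosh_mul (l x : ℝ) :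
    HasDerivAt (fun y => cosh (l * y)) (l * sinh (l * x)) x := by
  simpa [mul_comm] using ((hasDerivAt_id x).const_mul l).cosh

lemma hasDerivAt_exp_mul (l x : ℝ) :
    HasDerivAt (fun y => exp (l * y)) (l * exp (l * x)) x := by
  simpa [mul_comm] using ((hasDerivAt_id x).const_mul l).exp

lemma hasDerivAt_cosh_add_sinh (l s x : ℝ) :
    HasDerivAt (fun y => cosh (l * y) + s * sinh (l * y))
      (l * (sinh (l * x) + s * cosh (l * x))) x := by
  exact ((hasDerivAt_cosh_mul l x).add ((hasDerivAt_sinh_mul l x).const_mul s)).congr_deriv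
    (by ring)

lemma deriv_psi_of_neg (σ₁ σ₂ r : ℝ) {x : ℝ} (hx : x < 0) :
    deriv (psi σ₁ σ₂ r) x = √(2 * r) / σ₁ * exp (√(2 * r) / σ₁ * x) := by
  refine ((hasDerivAt_exp_mul _ x).congr_of_eventuallyEq ?_).deriv
  filter_upwards [Iio_mem_nhds hx] with y hy using psi_of_nonpos σ₁ σ₂ r (le_of_lt hy)

lemma deriv_psi_of_nonneg {σ₂ : ℝ} (σ₁ r : ℝ) (hσ₂ : σ₂ ≠ 0) {x : ℝ} (hx : 0 ≤ x) :
    deriv (psi σ₁ σ₂ r) x = √(2 * r) / σ₂ *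
      (sinh (√(2 * r) / σ₂ * x) + σ₂ / σ₁ * cosh (√(2 * r) / σ₂ * x)) := by
  have hR := hasDerivAt_cosh_add_sinh (√(2 * r) / σ₂) (σ₂ / σ₁) x
  rcases hx.lt_or_eq with h | rfl
  · refine (hR.congr_of_eventuallyEq ?_).deriv
    filter_upwards [Ioi_mem_nhds h] with y hy using psi_of_nonneg σ₁ σ₂ r (le_of_lt hy)
  · have hL := hasDerivAt_exp_mul (√(2 * r) / σ₁) 0
    have hslope : √(2 * r) / σ₁ * exp (√(2 * r) / σ₁ * 0) = √(2 * r) / σ₂ *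
        (sinh (√(2 * r) / σ₂ * 0) + σ₂ / σ₁ * cosh (√(2 * r) / σ₂ * 0)) := by
      simp only [mul_zero, exp_zero, sinh_zero, cosh_zero, zero_add, mul_one]
      field_simp
    rw [hslope] at hL
    have hL' := hL.hasDerivWithinAt (s := Iic 0) |>.congr
      (fun y hy => psi_of_nonpos σ₁ σ₂ r hy) (psi_of_nonpos σ₁ σ₂ r le_rfl)
    have hR' := hR.hasDerivWithinAt (s := Ici 0) |>.congr
      (fun y hy => psi_of_nonneg σ₁ σ₂ r hy) (psi_of_nonneg σ₁ σ₂ r le_rfl)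
    have h := hL'.union hR'
    rw [Iic_union_Ici, hasDerivWithinAt_univ] at h
    exact h.deriv

lemma Gfun_of_neg (σ₁ σ₂ r : ℝ) {x : ℝ} (hx : x < 0) :
    Gfun σ₁ σ₂ r x =
      (1 + x) * (exp (√(2 * r) / σ₁ * x) * (√(2 * r) / σ₁ * (1 + x) - 2)) := by
  rw [Gfun, deriv_psi_of_neg σ₁ σ₂ r hx, psi_of_nonpos σ₁ σ₂ r hx.le]
  ring

lemma Gfun_of_nonneg {σ₂ : ℝ} (σ₁ r : ℝ) (hσ₂ : σ₂ ≠ 0) {x : ℝ} (hx : 0 ≤ x) :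
    Gfun σ₁ σ₂ r x = (1 + x) * reducedG (√(2 * r) / σ₂) (σ₂ / σ₁) x := by
  rw [Gfun, deriv_psi_of_nonneg σ₁ r hσ₂ hx, psi_of_nonneg σ₁ σ₂ r hx, reducedG]
  ring

lemma reducedG_zero (l s : ℝ) : reducedG l s 0 = l * s - 2 := by
  simp [reducedG]

lemma hasDerivAt_reducedG (l s x : ℝ) :
    HasDerivAt (reducedG l s)
      (l * (l * (1 + x) * (cosh (l * x) + s * sinh (l * x)) -
        (sinh (l * x) + s * cosh (l * x)))) x := by
  have h1 := (hasDerivAt_sinh_mul l x).add ((hasDerivAt_cosh_mul l x).const_mul s)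
  have h2 := (h1.const_mul l).mul ((hasDerivAt_id x).const_add 1)
  have h3 := h2.sub ((hasDerivAt_cosh_add_sinh l s x).const_mul 2)
  refine h3.congr_deriv ?_
  simp only [id, Pi.add_apply]
  ring

lemma hasDerivAt_deriv_reducedG (l s x : ℝ) :
    HasDerivAt (deriv (reducedG l s))
      (l ^ 3 * (1 + x) * (sinh (l * x) + s * cosh (l * x))) x := by
  rw [funext fun y => (hasDerivAt_reducedG l s y).deriv]
  have h1 := (((hasDerivAt_id x).const_add 1).const_mul l).mul (hasDerivAt_cosh_add_sinh l s x)
  have h2 := (hasDerivAt_sinh_mul l x).add ((hasDerivAt_cosh_mul l x).const_mul s)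
  refine ((h1.sub h2).const_mul l).congr_deriv ?_
  simp only [id]
  ring

lemma continuous_reducedG (l s : ℝ) : Continuous (reducedG l s) :=
  continuous_iff_continuousAt.2 fun x => (hasDerivAt_reducedG l s x).continuousAt

lemma convexOn_reducedG {l s : ℝ} (hl : 0 ≤ l) (hs : 0 ≤ s) :
    ConvexOn ℝ (Ici 0) (reducedG l s) := by
  refine convexOn_of_deriv2_nonneg (convex_Ici 0) (continuous_reducedG l s).continuousOn
    (fun x _ => (hasDerivAt_reducedG l s x).differentiableAt.differentiableWithinAt)
    (fun x _ => (hasDerivAt_deriv_reducedG l s x).differentiableAt.differentiableWithinAt)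
    fun x hx => ?_
  rw [interior_Ici, mem_Ioi] at hx
  have hsinh : 0 ≤ sinh (l * x) := sinh_nonneg_iff.2 (by positivity)
  have hcosh := cosh_pos (l * x)
  simp only [Function.iterate_succ, Function.iterate_zero, Function.comp_apply, id]
  rw [(hasDerivAt_deriv_reducedG l s x).deriv]
  positivity

lemma strictMonoOn_reducedG {l s : ℝ} (hs : 1 ≤ s) (hsl : s ≤ l) :
    StrictMonoOn (reducedG l s) (Ici 0) := by
  refine strictMonoOn_of_deriv_pos (convex_Ici 0) (continuous_reducedG l s).continuousOn
    fun x hx => ?_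
  rw [interior_Ici, mem_Ioi] at hx
  have hl : 0 < l := by linarith
  have hsinh : 0 ≤ sinh (l * x) := sinh_nonneg_iff.2 (by positivity)
  have hcosh := cosh_pos (l * x)
  rw [(hasDerivAt_reducedG l s x).deriv]
  refine mul_pos hl ?_
  have h1 : 0 < l * x * (cosh (l * x) + s * sinh (l * x)) := by positivity
  have h2 : 0 ≤ (l - s) * (cosh (l * x) + s * sinh (l * x)) :=
    mul_nonneg (by linarith) (by positivity)
  have h3 : 0 ≤ (s ^ 2 - 1) * sinh (l * x) := mul_nonneg (by nlinarith) hsinh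
  linarith

lemma reducedG_nonneg_at {l s : ℝ} (hl : 0 < l) (hs : 1 ≤ s) : 0 ≤ reducedG l s (2 * s / l) := by
  have hsinh : 0 ≤ sinh (l * (2 * s / l)) := sinh_nonneg_iff.2 (by positivity)
  have hcosh := cosh_pos (l * (2 * s / l))
  have hx : l * (1 + 2 * s / l) = l + 2 * s := by field_simp
  have h : reducedG l s (2 * s / l) =
      l * sinh (l * (2 * s / l)) + (l * s + 2 * (s ^ 2 - 1)) * cosh (l * (2 * s / l)) := by
    rw [reducedG]
    linear_combination (sinh (l * (2 * s / l)) + s * cosh (l * (2 * s / l))) * hx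
  rw [h]
  have : 0 ≤ s ^ 2 - 1 := by nlinarith
  positivity

lemma exists_pos_reducedG_eq_zero {l s : ℝ} (hl : 0 < l) (hs : 1 ≤ s) (h0 : l * s < 2) :
    ∃ c, 0 < c ∧ reducedG l s c = 0 := by
  have hM : 0 ≤ 2 * s / l := by positivity
  have hneg : reducedG l s 0 < 0 := by rw [reducedG_zero]; linarith
  obtain ⟨c, hc, hc0⟩ := intermediate_value_Icc hM (continuous_reducedG l s).continuousOn
    ⟨hneg.le, reducedG_nonneg_at hl hs⟩
  refine ⟨c, hc.1.lt_of_ne ?_, hc0⟩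
  rintro rfl
  exact hneg.ne hc0

/-- A convex function on `[0,∞)` that is negative at `0` is negative strictly before any zero. -/
lemma ConvexOn.neg_of_lt_zero {f : ℝ → ℝ} (hf : ConvexOn ℝ (Ici 0) f) (h0 : f 0 < 0)
    {y z : ℝ} (hy : 0 ≤ y) (hyz : y < z) (hz : f z = 0) : f y < 0 := by
  have hz0 : 0 < z := hy.trans_lt hyz
  have h : f ((1 - y / z) • 0 + (y / z) • z) ≤ (1 - y / z) • f 0 + (y / z) • f z :=
    hf.2 (mem_Ici.2 le_rfl) (mem_Ici.2 hz0.le) (sub_nonneg.2 ((div_le_one hz0).2 hyz.le))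
      (by positivity) (by ring)
  simp only [smul_eq_mul, mul_zero, zero_add, hz, add_zero, div_mul_cancel₀ y hz0.ne'] at h
  have : 0 < 1 - y / z := sub_pos.2 ((div_lt_one hz0).2 hyz)
  nlinarith

lemma reducedG_zero_unique {l s : ℝ} (hl : 0 ≤ l) (hs : 0 ≤ s) (h0 : l * s < 2)
    {y z : ℝ} (hy : 0 ≤ y) (hz : 0 ≤ z) (hy0 : reducedG l s y = 0) (hz0 : reducedG l s z = 0) :
    y = z := by
  have hneg : reducedG l s 0 < 0 := by rw [reducedG_zero]; linarith
  rcases lt_trichotomy y z with h | h | h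
  · exact absurd hy0 ((convexOn_reducedG hl hs).neg_of_lt_zero hneg hy h hz0).ne
  · exact h
  · exact absurd hz0 ((convexOn_reducedG hl hs).neg_of_lt_zero hneg hz h hy0).ne

/-- Assume 0 < σ₁² ≤ σ₂² ≤ 2σ₁². For every r > 0, G has a unique zero c(r) in
(−1,∞); moreover c(r) > 0 if r < 2σ₁², c(r) = 0 if r = 2σ₁², c(r) < 0 if r > 2σ₁². -/
theorem stmt_12 (σ₁ σ₂ : ℝ) (hσ₁ : 0 < σ₁) (hσ₂ : 0 < σ₂)
    (h12 : σ₁^2 ≤ σ₂^2) (h21 : σ₂^2 ≤ 2*σ₁^2) :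
    ∀ r > (0:ℝ), ∃ c : ℝ, -1 < c ∧ Gfun σ₁ σ₂ r c = 0 ∧
      (∀ y : ℝ, -1 < y → Gfun σ₁ σ₂ r y = 0 → y = c) ∧
      (r < 2*σ₁^2 → 0 < c) ∧ (r = 2*σ₁^2 → c = 0) ∧ (2*σ₁^2 < r → c < 0) := by
  intro r hr
  have hL : 0 < √(2 * r) / σ₁ := by positivity
  have hl : 0 < √(2 * r) / σ₂ := by positivity
  have hs : 1 ≤ σ₂ / σ₁ := (one_le_div hσ₁).2 ((sq_le_sq₀ hσ₁.le hσ₂.le).1 h12)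
  have hs2 : (σ₂ / σ₁) ^ 2 ≤ 2 := by
    rw [div_pow, div_le_iff₀ (by positivity)]
    exact h21
  have hls : √(2 * r) / σ₂ * (σ₂ / σ₁) = √(2 * r) / σ₁ := by field_simp
  have hLsq : (√(2 * r) / σ₁) ^ 2 * σ₁ ^ 2 = 2 * r := by
    rw [div_pow, sq_sqrt (by positivity)]
    field_simp
  have hneg {y : ℝ} (h1 : -1 < y) (h2 : y < 0) :
      Gfun σ₁ σ₂ r y = 0 ↔ √(2 * r) / σ₁ * (1 + y) = 2 := by
    have : 1 + y ≠ 0 := by linarith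
    rw [Gfun_of_neg σ₁ σ₂ r h2]
    simp [this, exp_ne_zero, sub_eq_zero]
  have hnonneg {y : ℝ} (h : 0 ≤ y) :
      Gfun σ₁ σ₂ r y = 0 ↔ reducedG (√(2 * r) / σ₂) (σ₂ / σ₁) y = 0 := by
    have : 1 + y ≠ 0 := by linarith
    rw [Gfun_of_nonneg σ₁ r hσ₂.ne' h]
    simp [this]
  have hσ₁sq : 0 < σ₁ ^ 2 := by positivity
  generalize √(2 * r) / σ₁ = L at *
  generalize √(2 * r) / σ₂ = l at *
  generalize σ₂ / σ₁ = s at *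
  have hr_lt : r < 2 * σ₁ ^ 2 → L < 2 := fun h => by
    by_contra! hL2
    nlinarith [mul_le_mul_of_nonneg_right (show (4 : ℝ) ≤ L ^ 2 by nlinarith) hσ₁sq.le]
  have hr_gt : 2 * σ₁ ^ 2 < r → 2 < L := fun h => by
    by_contra! hL2
    nlinarith [mul_le_mul_of_nonneg_right (show L ^ 2 ≤ 4 by nlinarith) hσ₁sq.le]
  have hr_eq : r = 2 * σ₁ ^ 2 → L = 2 := fun h => by
    have h4 : L ^ 2 = 4 := mul_right_cancel₀ hσ₁sq.ne' (by linarith)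
    nlinarith
  have hmono (h2 : 2 ≤ L) : StrictMonoOn (reducedG l s) (Ici 0) := by
    refine strictMonoOn_reducedG hs (le_of_mul_le_mul_right ?_ (by linarith : 0 < s))
    nlinarith
  rcases lt_trichotomy L 2 with h | h | h
  · obtain ⟨c, hc, hc0⟩ := exists_pos_reducedG_eq_zero hl hs (hls.trans_lt h)
    refine ⟨c, by linarith, (hnonneg hc.le).2 hc0, fun y hy hy0 => ?_, fun _ => hc,
      fun h' => absurd (hr_eq h') h.ne, fun h' => absurd (hr_gt h') h.not_gt⟩
    rcases lt_or_ge y 0 with hy' | hy'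
    · have := (hneg hy hy').1 hy0
      nlinarith
    · exact reducedG_zero_unique hl.le (by linarith) (hls.trans_lt h) hy' hc.le
        ((hnonneg hy').1 hy0) hc0
  · have h0 : reducedG l s 0 = 0 := by rw [reducedG_zero]; linarith
    refine ⟨0, by norm_num, (hnonneg le_rfl).2 h0, fun y hy hy0 => ?_,
      fun h' => absurd h (hr_lt h').ne, fun _ => rfl, fun h' => absurd h (hr_gt h').ne'⟩
    rcases lt_or_ge y 0 with hy' | hy'
    · have := (hneg hy hy').1 hy0
      nlinarith
    · exact (hmono h.ge).injOn hy' (mem_Ici.2 le_rfl) (((hnonneg hy').1 hy0).trans h0.symm)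
  · have hc1 : -1 < 2 / L - 1 := by linarith [div_pos two_pos hL]
    have hc0 : 2 / L - 1 < 0 := by linarith [(div_lt_one hL).2 h]
    refine ⟨2 / L - 1, hc1, (hneg hc1 hc0).2 (by field_simp; ring), fun y hy hy0 => ?_,
      fun h' => absurd (hr_lt h') h.not_gt, fun h' => absurd (hr_eq h') h.ne', fun _ => hc0⟩
    rcases lt_or_ge y 0 with hy' | hy'
    · have := (hneg hy hy').1 hy0
      rw [← this]
      field_simp
      ring
    · have h1 := (hmono h.le).monotoneOn (mem_Ici.2 le_rfl) hy' hy'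
      rw [(hnonneg hy').1 hy0, reducedG_zero] at h1
      linarith
end

section
/- There exists a unique pair of real numbers (A, B) such that the function F defined by F(x) = A·exp(λ₁ x) + B·exp(−λ₁ x) for x ≤ 0 and F(x) = (1+x)² for x ≥ 0 is differentiable at 0 (equivalently, A + B = 1 and λ₁(A − B) = 2); namely A = (λ₁ + 2)/(2λ₁) and B = (λ₁ − 2)/(2λ₁). Moreover B ≥ 0 if and only if r ≥ 2σ₁²; if r ≥ 2σ₁² then F is strictly positive on (−∞, 0); and if r < 2σ₁² then B < 0 and F(x) → −∞ as x → −∞. In all cases F satisfies (σ₁²/2)·F″(x) = r·F(x) for every x < 0. -/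
open Real Filter Set

/-- Candidate value function: r-harmonic on (−∞,0) glued to the quadratic
reward (1+x)² at 0. -/
noncomputable def Ffun (σ₁ r A B x : ℝ) : ℝ :=
  if x < 0 then A * Real.exp (Real.sqrt (2*r)/σ₁ * x)
              + B * Real.exp (-(Real.sqrt (2*r)/σ₁) * x)
  else (1 + x)^2

open scoped Topology

lemma hasDerivAt_exp_combination (l A B x : ℝ) :
    HasDerivAt (fun y => A * Real.exp (l * y) + B * Real.exp (-l * y))
      (l * A * Real.exp (l * x) + -l * B * Real.exp (-l * x)) x := by
  have h (c C : ℝ) : HasDerivAt (fun y => C * Real.exp (c * y)) (c * C * Real.exp (c * x)) x :=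
    ((((hasDerivAt_id' x).const_mul c).exp).const_mul C).congr_deriv (by ring)
  exact (h l A).add (h (-l) B)

lemma Ffun_of_neg {x : ℝ} (σ₁ r A B : ℝ) (hx : x < 0) :
    Ffun σ₁ r A B x =
      A * Real.exp (√(2 * r) / σ₁ * x) + B * Real.exp (-(√(2 * r) / σ₁) * x) :=
  if_pos hx

lemma Ffun_of_nonneg {x : ℝ} (σ₁ r A B : ℝ) (hx : 0 ≤ x) :
    Ffun σ₁ r A B x = (1 + x) ^ 2 :=
  if_neg hx.not_gt

lemma hasDerivWithinAt_Ffun_Ici (σ₁ r A B : ℝ) :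
    HasDerivWithinAt (Ffun σ₁ r A B) 2 (Ici 0) 0 := by
  have h : HasDerivAt (fun x : ℝ => (1 + x) ^ 2) 2 0 := by
    simpa using ((hasDerivAt_id' (0 : ℝ)).const_add 1).fun_pow 2
  exact h.hasDerivWithinAt.congr (fun x hx => Ffun_of_nonneg σ₁ r A B hx)
    (Ffun_of_nonneg σ₁ r A B le_rfl)

lemma hasDerivWithinAt_Ffun_Iic (σ₁ r : ℝ) {A B : ℝ} (hAB : A + B = 1) :
    HasDerivWithinAt (Ffun σ₁ r A B) (√(2 * r) / σ₁ * (A - B)) (Iic 0) 0 := by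
  have h := (hasDerivAt_exp_combination (√(2 * r) / σ₁) A B 0).hasDerivWithinAt (s := Iic 0)
  have h0 : Ffun σ₁ r A B 0 =
      A * Real.exp (√(2 * r) / σ₁ * 0) + B * Real.exp (-(√(2 * r) / σ₁) * 0) := by
    simp [Ffun_of_nonneg, hAB]
  refine (h.congr (fun x hx => ?_) h0).congr_deriv ?_
  · rcases (mem_Iic.mp hx).lt_or_eq with hx | rfl
    · exact Ffun_of_neg σ₁ r A B hx
    · exact h0
  · simp only [mul_zero, Real.exp_zero]
    ring

lemma add_eq_one_of_continuousAt_Ffun {σ₁ r A B : ℝ} (h : ContinuousAt (Ffun σ₁ r A B) 0) :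
    A + B = 1 := by
  have h₁ : Tendsto (Ffun σ₁ r A B) (𝓝[<] 0) (𝓝 1) := by
    simpa [Ffun_of_nonneg] using h.tendsto.mono_left (nhdsWithin_le_nhds (s := Iio 0))
  have h₂ : Tendsto (Ffun σ₁ r A B) (𝓝[<] 0) (𝓝 (A + B)) := by
    have := (hasDerivAt_exp_combination (√(2 * r) / σ₁) A B 0).continuousAt.tendsto.mono_left
      (nhdsWithin_le_nhds (s := Iio 0))
    simp only [mul_zero, Real.exp_zero, mul_one] at this
    refine this.congr' ?_
    filter_upwards [self_mem_nhdsWithin] with x hx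
    exact (Ffun_of_neg σ₁ r A B hx).symm
  exact tendsto_nhds_unique h₂ h₁

lemma differentiableAt_Ffun_zero_iff (σ₁ r A B : ℝ) :
    DifferentiableAt ℝ (Ffun σ₁ r A B) 0 ↔ A + B = 1 ∧ √(2 * r) / σ₁ * (A - B) = 2 := by
  constructor
  · intro h
    have hAB := add_eq_one_of_continuousAt_Ffun h.continuousAt
    have hl := (uniqueDiffOn_Iic (0 : ℝ) 0 self_mem_Iic).eq_deriv _
      (hasDerivWithinAt_Ffun_Iic σ₁ r hAB) h.hasDerivAt.hasDerivWithinAt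
    have hu := (uniqueDiffOn_Ici (0 : ℝ) 0 self_mem_Ici).eq_deriv _
      (hasDerivWithinAt_Ffun_Ici σ₁ r A B) h.hasDerivAt.hasDerivWithinAt
    exact ⟨hAB, hl.trans hu.symm⟩
  · rintro ⟨hAB, hd⟩
    have h := (hasDerivWithinAt_Ffun_Iic σ₁ r hAB).union
      (hd ▸ hasDerivWithinAt_Ffun_Ici σ₁ r A B)
    rw [Iic_union_Ici, hasDerivWithinAt_univ] at h
    exact h.differentiableAt

lemma deriv_deriv_Ffun_of_neg {x : ℝ} (σ₁ r A B : ℝ) (hx : x < 0) :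
    deriv (deriv (Ffun σ₁ r A B)) x = (√(2 * r) / σ₁) ^ 2 * Ffun σ₁ r A B x := by
  set l := √(2 * r) / σ₁ with hl
  have h₁ : ∀ y < 0, deriv (Ffun σ₁ r A B) y =
      l * A * Real.exp (l * y) + -l * B * Real.exp (-l * y) := fun y hy => by
    refine ((hasDerivAt_exp_combination l A B y).congr_of_eventuallyEq ?_).deriv
    filter_upwards [Iio_mem_nhds hy] with z hz
    exact Ffun_of_neg σ₁ r A B hz
  have h₂ : deriv (Ffun σ₁ r A B) =ᶠ[𝓝 x]
      fun y => l * A * Real.exp (l * y) + -l * B * Real.exp (-l * y) := by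
    filter_upwards [Iio_mem_nhds hx] with y hy
    exact h₁ y hy
  rw [h₂.deriv_eq, (hasDerivAt_exp_combination l (l * A) (-l * B) x).deriv,
    Ffun_of_neg σ₁ r A B hx, ← hl]
  ring

lemma tendsto_Ffun_atBot {σ₁ r A B : ℝ} (hl : 0 < √(2 * r) / σ₁) (hB : B < 0) :
    Tendsto (Ffun σ₁ r A B) atBot atBot := by
  have h₁ : Tendsto (fun x => A * Real.exp (√(2 * r) / σ₁ * x)) atBot (𝓝 (A * 0)) :=
    (Real.tendsto_exp_atBot.comp (tendsto_id.const_mul_atBot hl)).const_mul A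
  have h₂ : Tendsto (fun x => B * Real.exp (-(√(2 * r) / σ₁) * x)) atBot atBot :=
    (Real.tendsto_exp_atTop.comp
      (tendsto_id.const_mul_atBot_of_neg (neg_neg_of_pos hl))).const_mul_atTop_of_neg hB
  refine (h₁.add_atBot h₂).congr' ?_
  filter_upwards [Iio_mem_atBot (0 : ℝ)] with x hx
  exact (Ffun_of_neg σ₁ r A B hx).symm

lemma two_le_sqrt_two_mul_div_iff {σ₁ r : ℝ} (hσ₁ : 0 < σ₁) :
    2 ≤ √(2 * r) / σ₁ ↔ 2 * σ₁ ^ 2 ≤ r := by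
  rw [le_div_iff₀ hσ₁, Real.le_sqrt' (by positivity)]
  constructor <;> intro h <;> linarith

/-- There is a unique pair (A,B) making F differentiable at 0, namely
A = (λ₁+2)/(2λ₁), B = (λ₁−2)/(2λ₁) (equivalently A+B = 1 and λ₁(A−B) = 2), where
λ₁ = √(2r)/σ₁. Moreover B ≥ 0 ↔ r ≥ 2σ₁²; if r ≥ 2σ₁² then F > 0 on (−∞,0);
if r < 2σ₁² then B < 0 and F(x) → −∞ as x → −∞; and (σ₁²/2)·F″ = r·F on (−∞,0). -/
theorem stmt_14 (σ₁ σ₂ r : ℝ) (hσ₁ : 0 < σ₁) (hσ₂ : 0 < σ₂) (hr : 0 < r) :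
    (∃! p : ℝ × ℝ, DifferentiableAt ℝ (Ffun σ₁ r p.1 p.2) 0) ∧
    DifferentiableAt ℝ
      (Ffun σ₁ r ((Real.sqrt (2*r)/σ₁ + 2)/(2*(Real.sqrt (2*r)/σ₁)))
                 ((Real.sqrt (2*r)/σ₁ - 2)/(2*(Real.sqrt (2*r)/σ₁)))) 0 ∧
    (Real.sqrt (2*r)/σ₁ + 2)/(2*(Real.sqrt (2*r)/σ₁))
      + (Real.sqrt (2*r)/σ₁ - 2)/(2*(Real.sqrt (2*r)/σ₁)) = 1 ∧
    Real.sqrt (2*r)/σ₁ *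
      ((Real.sqrt (2*r)/σ₁ + 2)/(2*(Real.sqrt (2*r)/σ₁))
        - (Real.sqrt (2*r)/σ₁ - 2)/(2*(Real.sqrt (2*r)/σ₁))) = 2 ∧
    (0 ≤ (Real.sqrt (2*r)/σ₁ - 2)/(2*(Real.sqrt (2*r)/σ₁)) ↔ 2*σ₁^2 ≤ r) ∧
    (2*σ₁^2 ≤ r → ∀ x < (0:ℝ),
      0 < Ffun σ₁ r ((Real.sqrt (2*r)/σ₁ + 2)/(2*(Real.sqrt (2*r)/σ₁)))
                    ((Real.sqrt (2*r)/σ₁ - 2)/(2*(Real.sqrt (2*r)/σ₁))) x) ∧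
    (r < 2*σ₁^2 →
      (Real.sqrt (2*r)/σ₁ - 2)/(2*(Real.sqrt (2*r)/σ₁)) < 0 ∧
      Tendsto (Ffun σ₁ r ((Real.sqrt (2*r)/σ₁ + 2)/(2*(Real.sqrt (2*r)/σ₁)))
                         ((Real.sqrt (2*r)/σ₁ - 2)/(2*(Real.sqrt (2*r)/σ₁))))
        atBot atBot) ∧
    (∀ x < (0:ℝ),
      σ₁^2/2 * deriv (deriv
        (Ffun σ₁ r ((Real.sqrt (2*r)/σ₁ + 2)/(2*(Real.sqrt (2*r)/σ₁)))
                   ((Real.sqrt (2*r)/σ₁ - 2)/(2*(Real.sqrt (2*r)/σ₁))))) x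
        = r * Ffun σ₁ r ((Real.sqrt (2*r)/σ₁ + 2)/(2*(Real.sqrt (2*r)/σ₁)))
                        ((Real.sqrt (2*r)/σ₁ - 2)/(2*(Real.sqrt (2*r)/σ₁))) x) := by
  have hl : 0 < √(2 * r) / σ₁ := by positivity
  have hl_sq : σ₁ ^ 2 / 2 * (√(2 * r) / σ₁) ^ 2 = r := by
    rw [div_pow, Real.sq_sqrt (by positivity)]
    field_simp
  have hB_iff : 0 ≤ (√(2 * r) / σ₁ - 2) / (2 * (√(2 * r) / σ₁)) ↔ 2 * σ₁ ^ 2 ≤ r := by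
    rw [le_div_iff₀ (by positivity), zero_mul, sub_nonneg, two_le_sqrt_two_mul_div_iff hσ₁]
  have hsum : (√(2 * r) / σ₁ + 2) / (2 * (√(2 * r) / σ₁))
      + (√(2 * r) / σ₁ - 2) / (2 * (√(2 * r) / σ₁)) = 1 := by
    generalize √(2 * r) / σ₁ = l at hl
    field_simp
    ring
  have hdiff : √(2 * r) / σ₁ * ((√(2 * r) / σ₁ + 2) / (2 * (√(2 * r) / σ₁))
      - (√(2 * r) / σ₁ - 2) / (2 * (√(2 * r) / σ₁))) = 2 := by
    generalize √(2 * r) / σ₁ = l at hl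
    field_simp
    ring
  have hF := (differentiableAt_Ffun_zero_iff σ₁ r _ _).mpr ⟨hsum, hdiff⟩
  refine ⟨⟨(_, _), hF, ?_⟩, hF, hsum, hdiff, hB_iff, ?_, ?_, ?_⟩
  · rintro ⟨A, B⟩ h
    obtain ⟨hAB, hd⟩ := (differentiableAt_Ffun_zero_iff σ₁ r A B).mp h
    have := mul_left_cancel₀ hl.ne' (hd.trans hdiff.symm)
    exact Prod.ext (by linarith) (by linarith)
  · intro h x hx
    rw [Ffun_of_neg _ _ _ _ hx]
    have hB := hB_iff.mpr h
    positivity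
  · intro h
    have hB := not_le.mp (mt hB_iff.mp h.not_ge)
    exact ⟨hB, tendsto_Ffun_atBot hl hB⟩
  · intro x hx
    rw [deriv_deriv_Ffun_of_neg _ _ _ _ hx, ← mul_assoc, hl_sq]
end

section
/- Assume σ₁² ≥ σ₂² > 0. Then for every r > 0 the function G has exactly one zero c(r) in (−1, ∞), and c(r) > 0 if r < 2σ₁², c(r) = 0 if r = 2σ₁², and c(r) < 0 if r > 2σ₁². -/
open Real Filter Set

/-- The logarithmic derivative of `psi`, a continuous function of the positive part of `x`. -/
noncomputable def psiLogDeriv (σ₁ σ₂ r x : ℝ) : ℝ :=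
  Real.sqrt (2*r)/σ₂ *
    ((1 + σ₂/σ₁)/2 * Real.exp (Real.sqrt (2*r)/σ₂ * max x 0)
      - (1 - σ₂/σ₁)/2 * Real.exp (-(Real.sqrt (2*r)/σ₂) * max x 0)) /
    ((1 + σ₂/σ₁)/2 * Real.exp (Real.sqrt (2*r)/σ₂ * max x 0)
      + (1 - σ₂/σ₁)/2 * Real.exp (-(Real.sqrt (2*r)/σ₂) * max x 0))

section Psi

variable {σ₁ σ₂ r : ℝ}

lemma exp_combination_pos (hσ₁ : 0 < σ₁) (hσ₂ : 0 < σ₂) (h : σ₂ ≤ σ₁) (b x : ℝ) :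
    0 < (1 + σ₂/σ₁)/2 * Real.exp (b * x) + (1 - σ₂/σ₁)/2 * Real.exp (-b * x) := by
  have h1 : σ₂/σ₁ ≤ 1 := (div_le_one hσ₁).2 h
  have h2 : 0 ≤ (1 - σ₂/σ₁)/2 := by linarith
  positivity

lemma psi_pos (hσ₁ : 0 < σ₁) (hσ₂ : 0 < σ₂) (h : σ₂ ≤ σ₁) (x : ℝ) :
    0 < psi σ₁ σ₂ r x := by
  unfold psi
  split_ifs
  · positivity
  · exact exp_combination_pos hσ₁ hσ₂ h _ x

lemma psiLogDeriv_of_nonpos (hσ₂ : 0 < σ₂) {x : ℝ} (hx : x ≤ 0) :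
    psiLogDeriv σ₁ σ₂ r x = Real.sqrt (2*r)/σ₁ := by
  simp only [psiLogDeriv, max_eq_right hx, mul_zero, Real.exp_zero]
  have : (1 + σ₂/σ₁)/2 * 1 + (1 - σ₂/σ₁)/2 * 1 = 1 := by ring
  rw [this]
  field_simp
  ring

lemma psiLogDeriv_mono (hσ₁ : 0 < σ₁) (hσ₂ : 0 < σ₂) (h : σ₂ ≤ σ₁) :
    Monotone (psiLogDeriv σ₁ σ₂ r) := by
  intro x y hxy
  have hm : max x 0 ≤ max y 0 := max_le_max_right 0 hxy
  unfold psiLogDeriv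
  rw [div_le_div_iff₀ (exp_combination_pos hσ₁ hσ₂ h _ _) (exp_combination_pos hσ₁ hσ₂ h _ _)]
  generalize max x 0 = u at *
  generalize max y 0 = v at *
  have hb : 0 ≤ Real.sqrt (2*r)/σ₂ := by positivity
  generalize Real.sqrt (2*r)/σ₂ = b at *
  have h1 : σ₂/σ₁ ≤ 1 := (div_le_one hσ₁).2 h
  have hB : 0 ≤ (1 + σ₂/σ₁)/2 * ((1 - σ₂/σ₁)/2) :=
    mul_nonneg (by positivity) (by linarith)
  have he : Real.exp (b * u) * Real.exp (-b * v) ≤ Real.exp (b * v) * Real.exp (-b * u) := by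
    rw [← Real.exp_add, ← Real.exp_add, Real.exp_le_exp]
    nlinarith
  nlinarith [mul_le_mul_of_nonneg_left he (mul_nonneg hb hB)]

lemma continuous_psiLogDeriv (hσ₁ : 0 < σ₁) (hσ₂ : 0 < σ₂) (h : σ₂ ≤ σ₁) :
    Continuous (psiLogDeriv σ₁ σ₂ r) := by
  unfold psiLogDeriv
  exact Continuous.div (by fun_prop) (by fun_prop)
    fun x => (exp_combination_pos hσ₁ hσ₂ h _ _).ne'

lemma hasDerivAt_psi (hσ₁ : 0 < σ₁) (hσ₂ : 0 < σ₂) (h : σ₂ ≤ σ₁) (x : ℝ) :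
    HasDerivAt (psi σ₁ σ₂ r) (psi σ₁ σ₂ r x * psiLogDeriv σ₁ σ₂ r x) x := by
  have hexp (b y : ℝ) : HasDerivAt (fun z => Real.exp (b * z)) (Real.exp (b * y) * b) y := by
    simpa using ((hasDerivAt_id y).const_mul b).exp
  have hleft : ∀ y ≤ 0, psi σ₁ σ₂ r y = Real.exp (Real.sqrt (2*r)/σ₁ * y) := by
    intro y hy
    rcases hy.lt_or_eq with hy | rfl
    · simp [psi, hy]
    · simp only [psi, lt_irrefl, if_false, mul_zero, Real.exp_zero]
      ring
  have hright : ∀ y, 0 ≤ y → psi σ₁ σ₂ r y =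
      (1 + σ₂/σ₁)/2 * Real.exp (Real.sqrt (2*r)/σ₂ * y)
        + (1 - σ₂/σ₁)/2 * Real.exp (-(Real.sqrt (2*r)/σ₂) * y) := by
    intro y hy
    simp [psi, not_lt.2 hy]
  have hdl : x ≤ 0 → HasDerivWithinAt (psi σ₁ σ₂ r)
      (psi σ₁ σ₂ r x * psiLogDeriv σ₁ σ₂ r x) (Iic 0) x := by
    intro hx
    rw [psiLogDeriv_of_nonpos hσ₂ hx, hleft x hx]
    exact (hexp _ x).hasDerivWithinAt.congr hleft (hleft x hx)
  have hdr : 0 ≤ x → HasDerivWithinAt (psi σ₁ σ₂ r)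
      (psi σ₁ σ₂ r x * psiLogDeriv σ₁ σ₂ r x) (Ici 0) x := by
    intro hx
    have hd := ((hexp (Real.sqrt (2*r)/σ₂) x).const_mul ((1 + σ₂/σ₁)/2)).add
      ((hexp (-(Real.sqrt (2*r)/σ₂)) x).const_mul ((1 - σ₂/σ₁)/2))
    refine (hd.hasDerivWithinAt.congr hright (hright x hx)).congr_deriv ?_
    rw [hright x hx, psiLogDeriv, max_eq_left hx,
      mul_div_cancel₀ _ (exp_combination_pos hσ₁ hσ₂ h _ x).ne']
    ring
  rcases lt_trichotomy x 0 with hx | hx | hx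
  · exact (hdl hx.le).hasDerivAt (Iic_mem_nhds hx)
  · have hu := (hdl hx.le).union (hdr hx.ge)
    rwa [Iic_union_Ici, hasDerivWithinAt_univ] at hu
  · exact (hdr hx.le).hasDerivAt (Ici_mem_nhds hx)

lemma Gfun_eq (hσ₁ : 0 < σ₁) (hσ₂ : 0 < σ₂) (h : σ₂ ≤ σ₁) (x : ℝ) :
    Gfun σ₁ σ₂ r x =
      (1 + x) * psi σ₁ σ₂ r x * ((1 + x) * psiLogDeriv σ₁ σ₂ r x - 2) := by
  rw [Gfun, (hasDerivAt_psi hσ₁ hσ₂ h x).deriv]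
  ring

lemma Gfun_eq_zero_iff (hσ₁ : 0 < σ₁) (hσ₂ : 0 < σ₂) (h : σ₂ ≤ σ₁) {x : ℝ} (hx : -1 < x) :
    Gfun σ₁ σ₂ r x = 0 ↔ (1 + x) * psiLogDeriv σ₁ σ₂ r x = 2 := by
  have h1 : 1 + x ≠ 0 := by linarith
  rw [Gfun_eq hσ₁ hσ₂ h, mul_eq_zero_iff_left (mul_ne_zero h1 (psi_pos hσ₁ hσ₂ h x).ne'),
    sub_eq_zero]

lemma sqrt_div_le_psiLogDeriv (hσ₁ : 0 < σ₁) (hσ₂ : 0 < σ₂) (h : σ₂ ≤ σ₁) (x : ℝ) :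
    Real.sqrt (2*r)/σ₁ ≤ psiLogDeriv σ₁ σ₂ r x := by
  rw [← psiLogDeriv_of_nonpos hσ₂ (min_le_right x 0)]
  exact psiLogDeriv_mono hσ₁ hσ₂ h (min_le_left x 0)

lemma strictMonoOn_mul_psiLogDeriv (hσ₁ : 0 < σ₁) (hσ₂ : 0 < σ₂) (h : σ₂ ≤ σ₁) (hr : 0 < r) :
    StrictMonoOn (fun x => (1 + x) * psiLogDeriv σ₁ σ₂ r x) (Ioi (-1)) := by
  intro x hx y _ hxy
  have hpos : 0 < psiLogDeriv σ₁ σ₂ r x :=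
    lt_of_lt_of_le (by positivity) (sqrt_div_le_psiLogDeriv hσ₁ hσ₂ h x)
  have hx' : -1 < x := hx
  exact mul_lt_mul (by linarith) (psiLogDeriv_mono hσ₁ hσ₂ h hxy.le) hpos (by linarith)

end Psi

/-- Assume σ₁² ≥ σ₂² > 0. For every r > 0, G has exactly one zero c(r) in (−1,∞),
with c(r) > 0 if r < 2σ₁², c(r) = 0 if r = 2σ₁², and c(r) < 0 if r > 2σ₁². -/
theorem stmt_18 (σ₁ σ₂ : ℝ) (hσ₁ : 0 < σ₁) (hσ₂ : 0 < σ₂) (h12 : σ₂^2 ≤ σ₁^2) :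
    ∀ r > (0:ℝ), ∃ c : ℝ, -1 < c ∧ Gfun σ₁ σ₂ r c = 0 ∧
      (∀ y : ℝ, -1 < y → Gfun σ₁ σ₂ r y = 0 → y = c) ∧
      (r < 2*σ₁^2 → 0 < c) ∧ (r = 2*σ₁^2 → c = 0) ∧ (2*σ₁^2 < r → c < 0) := by
  have h : σ₂ ≤ σ₁ := (sq_le_sq₀ hσ₂.le hσ₁.le).1 h12
  intro r hr
  have ha : 0 < Real.sqrt (2*r)/σ₁ := by positivity
  have hmono := strictMonoOn_mul_psiLogDeriv hσ₁ hσ₂ h hr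
  obtain ⟨c, hc, hc2⟩ : ∃ c : ℝ, -1 < c ∧ (1 + c) * psiLogDeriv σ₁ σ₂ r c = 2 := by
    have hle : (-1 : ℝ) ≤ 2 / (Real.sqrt (2*r)/σ₁) - 1 := by
      have : 0 < 2 / (Real.sqrt (2*r)/σ₁) := by positivity
      linarith
    have hcont : Continuous fun x => (1 + x) * psiLogDeriv σ₁ σ₂ r x :=
      (continuous_const.add continuous_id).mul (continuous_psiLogDeriv hσ₁ hσ₂ h)
    have htop : 2 ≤ (1 + (2 / (Real.sqrt (2*r)/σ₁) - 1)) *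
        psiLogDeriv σ₁ σ₂ r (2 / (Real.sqrt (2*r)/σ₁) - 1) := by
      rw [add_sub_cancel]
      calc (2 : ℝ) = 2 / (Real.sqrt (2*r)/σ₁) * (Real.sqrt (2*r)/σ₁) :=
            (div_mul_cancel₀ _ ha.ne').symm
        _ ≤ _ := mul_le_mul_of_nonneg_left (sqrt_div_le_psiLogDeriv hσ₁ hσ₂ h _) (by positivity)
    obtain ⟨c, hc, hc2⟩ := intermediate_value_Icc hle hcont.continuousOn ⟨by simp, htop⟩
    refine ⟨c, lt_of_le_of_ne hc.1 ?_, hc2⟩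
    rintro rfl
    norm_num at hc2
  have hzero : (1 + (0:ℝ)) * psiLogDeriv σ₁ σ₂ r 0 = Real.sqrt (2*r)/σ₁ := by
    rw [psiLogDeriv_of_nonpos hσ₂ le_rfl]
    ring
  have h0 : (0:ℝ) ∈ Ioi (-1) := by simp
  have hsq : (2*σ₁)^2 = 4*σ₁^2 := by ring
  refine ⟨c, hc, (Gfun_eq_zero_iff hσ₁ hσ₂ h hc).2 hc2, ?_, ?_, ?_, ?_⟩
  · intro y hy hGy
    exact hmono.injOn hy hc (((Gfun_eq_zero_iff hσ₁ hσ₂ h hy).1 hGy).trans hc2.symm)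
  · intro hlt
    rw [← hmono.lt_iff_lt h0 hc]
    simp only [hzero, hc2]
    rw [div_lt_iff₀ hσ₁, Real.sqrt_lt' (by positivity)]
    linarith
  · intro heq
    refine hmono.injOn hc h0 ?_
    simp only [hzero, hc2]
    rw [eq_div_iff hσ₁.ne', eq_comm, Real.sqrt_eq_iff_mul_self_eq (by positivity) (by positivity)]
    linarith
  · intro hlt
    rw [← hmono.lt_iff_lt hc h0]
    simp only [hzero, hc2]
    rw [lt_div_iff₀ hσ₁, Real.lt_sqrt (by positivity)]
    linarith
end
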